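/- Assume the conventions: X is an infinite, connected, locally finite, vertex-transitive simple graph satisfying (UBQ) with separation constant σ > 0, and suppose X does not have quadratic growth. Then for every λ ≥ 1 and c ≥ 0, the collection of vertex sets of all truncated (λ,c)-quasi-circles in X has limited jurisdiction: for every δ ≥ 0 there exists C ≥ 0 such that for every truncated (λ,c)-quasi-circle T in X and every finite connected component A of V ∖ N_δ(T(∗)), we have depth(A) < C. -/

import Mathlib

open SimpleGraph

/-- Closed `r`-neighbourhood of a set `A` in the graph metric of `X`. -/
def gnbhd {V : Type*} (X : SimpleGraph V) (A : Set V) (r : ℝ) : Set V :=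
  {v : V | ∃ a ∈ A, (X.dist v a : ℝ) ≤ r}

/-- The induced subgraph on `Z` is connected. -/
def ConnSet {V : Type*} (X : SimpleGraph V) (Z : Set V) : Prop :=
  (X.induce Z).Connected

/-- `U` is a connected component of the subset `S` of the vertex set: `U` is a
nonempty connected subset of `S` which is maximal among connected subsets of `S`. -/
def IsCompOf {V : Type*} (X : SimpleGraph V) (U S : Set V) : Prop :=
  U ⊆ S ∧ U.Nonempty ∧ ConnSet X U ∧
    ∀ U' : Set V, U ⊆ U' → U' ⊆ S → ConnSet X U' → U' = U

/-- A subset `Z` is narrow if it is quasi-isometric to a subset of `ℝ`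
with respect to the ambient graph metric. -/
def Narrow {V : Type*} (X : SimpleGraph V) (Z : Set V) : Prop :=
  ∃ (lam c : ℝ) (f : Z → ℝ), 1 ≤ lam ∧ 0 ≤ c ∧
    ∀ x y : Z, |f x - f y| ≤ lam * (X.dist x.1 y.1 : ℝ) + c ∧
      (X.dist x.1 y.1 : ℝ) ≤ lam * |f x - f y| + c

/-- A subset is wide if it is not narrow. -/
def Wide {V : Type*} (X : SimpleGraph V) (Z : Set V) : Prop := ¬ Narrow X Z

/-- `ρ : ℤ → V` is a bi-infinite `(lam, c)`-quasi-geodesic path. -/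
def IsBiQG {V : Type*} (X : SimpleGraph V) (lam c : ℝ) (ρ : ℤ → V) : Prop :=
  (∀ n : ℤ, X.Adj (ρ n) (ρ (n + 1))) ∧
    ∀ s t : ℤ, |(s : ℝ) - (t : ℝ)| / lam - c ≤ (X.dist (ρ s) (ρ t) : ℝ)

/-- A bi-infinite quasi-geodesic: a bi-infinite path which is a
`(lam, c)`-quasi-geodesic for some `lam ≥ 1`, `c ≥ 0`. -/
def IsBiQuasiGeodesic {V : Type*} (X : SimpleGraph V) (ρ : ℤ → V) : Prop :=
  ∃ lam c : ℝ, 1 ≤ lam ∧ 0 ≤ c ∧ IsBiQG X lam c ρ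

/-- The subset `S` has exactly two wide connected components. -/
def TwoWideComps {V : Type*} (X : SimpleGraph V) (S : Set V) : Prop :=
  ∃ U₁ U₂ : Set V, U₁ ≠ U₂ ∧
    IsCompOf X U₁ S ∧ IsCompOf X U₂ S ∧ Wide X U₁ ∧ Wide X U₂ ∧
    ∀ U : Set V, IsCompOf X U S → Wide X U → U = U₁ ∨ U = U₂

/-- The uniformly bisecting quasi-geodesics property with separation constant `σ`. -/
def UBQ {V : Type*} (X : SimpleGraph V) (σ : ℝ) : Prop :=
  ∀ ρ : ℤ → V, IsBiQuasiGeodesic X ρ →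
    TwoWideComps X ((gnbhd X (Set.range ρ) σ)ᶜ)

/-- One-way infinite path. -/
def IsRay {V : Type*} (X : SimpleGraph V) (w : ℕ → V) : Prop :=
  ∀ n : ℕ, X.Adj (w n) (w (n + 1))

/-- `d(w t, A) → ∞` as `t → ∞`. -/
def DivergesFrom {V : Type*} (X : SimpleGraph V) (w : ℕ → V) (A : Set V) : Prop :=
  ∀ M : ℝ, ∃ N : ℕ, ∀ t : ℕ, N ≤ t → ∀ a ∈ A, M < (X.dist (w t) a : ℝ)

/-- `(w₁, w₂)` is a pair of witnesses for the bi-infinite quasi-geodesic `ρ`: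
they are one-way infinite simple paths lying in distinct wide components of the
complement of `N_σ(ρ(ℤ))`, both diverging from `ρ`. -/
def WitnessPair {V : Type*} (X : SimpleGraph V) (σ : ℝ) (ρ : ℤ → V)
    (w₁ w₂ : ℕ → V) : Prop :=
  IsRay X w₁ ∧ Function.Injective w₁ ∧ IsRay X w₂ ∧ Function.Injective w₂ ∧
  (∃ U₁ U₂ : Set V, U₁ ≠ U₂ ∧
    IsCompOf X U₁ ((gnbhd X (Set.range ρ) σ)ᶜ) ∧ Wide X U₁ ∧
    IsCompOf X U₂ ((gnbhd X (Set.range ρ) σ)ᶜ) ∧ Wide X U₂ ∧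
    Set.range w₁ ⊆ U₁ ∧ Set.range w₂ ⊆ U₂) ∧
  DivergesFrom X w₁ (Set.range ρ) ∧ DivergesFrom X w₂ (Set.range ρ)

/-- Concatenation of the reversal of the ray `a` with the ray `b`, as a
bi-infinite path (`t ↦ a (-t)` for `t ≤ 0` and `t ↦ b t` for `t ≥ 0`). -/
def biconcat {V : Type*} (a b : ℕ → V) : ℤ → V :=
  fun t => if t < 0 then a (-t).toNat else b t.toNat

/-- One-way infinite `(lam, c)`-quasi-geodesic ray. -/
def IsQGRay {V : Type*} (X : SimpleGraph V) (lam c : ℝ) (γ : ℕ → V) : Prop :=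
  IsRay X γ ∧
    ∀ s t : ℕ, |(s : ℝ) - (t : ℝ)| / lam - c ≤ (X.dist (γ s) (γ t) : ℝ)

/-- An `(R, r, lam, c)`-cross-examiner, with the three rays `γ i`, the three
witnesses `w i` and the three finite paths `q i` (of length `qn i`) indexed by
`ZMod 3` (where the paper's index `3` corresponds to `0 : ZMod 3`). -/
def IsCrossExaminer {V : Type*} (X : SimpleGraph V) (σ R r lam c : ℝ) (v₀ : V)
    (γ w : ZMod 3 → ℕ → V) (q : ZMod 3 → ℕ → V) (qn : ZMod 3 → ℕ) : Prop :=
  1 ≤ lam ∧ 0 ≤ c ∧ 10 * σ < r ∧ r < R ∧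
  (∀ i : ZMod 3, IsQGRay X lam c (γ i) ∧ γ i 0 = v₀ ∧ IsRay X (w i) ∧
    (∀ j : ℕ, j < qn i → X.Adj (q i j) (q i (j + 1)))) ∧
  ∀ i : ZMod 3,
    -- (CE1)
    IsBiQG X lam c (biconcat (γ (i + 1)) (γ (i + 2))) ∧
    -- (CE2)
    (∃ U : Set V,
      IsCompOf X U (Set.range (biconcat (γ (i + 1)) (γ (i + 2))) \
        gnbhd X (q 0 '' Set.Iic (qn 0) ∪ q 1 '' Set.Iic (qn 1) ∪ q 2 '' Set.Iic (qn 2))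
          (10 * σ)) ∧ w i 0 ∈ U ∧ v₀ ∈ U) ∧
    -- (CE3)
    WitnessPair X σ (biconcat (γ (i + 1)) (γ (i + 2))) (w i) (γ i) ∧
    -- (CE4)
    (∀ t : ℕ, r < (t : ℝ) → ∀ s : ℤ,
      10 * σ < (X.dist (w i t) (biconcat (γ (i + 1)) (γ (i + 2)) s) : ℝ)) ∧
    -- (CE5)
    (q i 0 ∈ Set.range (γ (i + 1)) ∧ q i (qn i) ∈ Set.range (γ (i + 2)) ∧
      (q i '' Set.Iic (qn i)) ∩
        gnbhd X (Set.range (w (i + 1)) ∪ Set.range (w (i + 2)) ∪ Set.range (γ i))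
          (10 * σ) = ∅) ∧
    -- (CE6)
    q i '' Set.Iic (qn i) ⊆ gnbhd X {v₀} (R - 10 * σ) \ gnbhd X {v₀} (r + 10 * σ)

/-- `X` has quadratic growth. -/
def QuadGrowth {V : Type*} (X : SimpleGraph V) : Prop :=
  ∃ C : ℝ, 0 < C ∧ ∀ v : V, ∀ n : ℕ, 1 ≤ n →
    ({u : V | X.dist u v ≤ n}.ncard : ℝ) ≤ C * (n : ℝ) ^ 2

/-- The set of vertices at distance exactly `1` from `A`. -/
def vertexBoundary {V : Type*} (X : SimpleGraph V) (A : Set V) : Set V :=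
  {v : V | v ∉ A ∧ ∃ a ∈ A, X.Adj v a}

/-- The depth of `A`: `inf {r ≥ 0 : A ⊆ N_r(∂A)}`. -/
noncomputable def gdepth {V : Type*} (X : SimpleGraph V) (A : Set V) : ℝ :=
  sInf {r : ℝ | 0 ≤ r ∧ A ⊆ gnbhd X (vertexBoundary X A) r}

/-- A `(lam, c)`-quasi-circle of length `n ≥ 1`: a closed path all of whose
subpaths of length at most `n / 2` are `(lam, c)`-quasi-geodesics. -/
def IsQuasiCircle {V : Type*} (X : SimpleGraph V) (lam c : ℝ) (n : ℕ)
    (C : ZMod n → V) : Prop :=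
  1 ≤ n ∧ (∀ k : ZMod n, X.Adj (C k) (C (k + 1))) ∧
    ∀ (k : ZMod n) (m s t : ℕ), 2 * m ≤ n → s ≤ m → t ≤ m →
      |(s : ℝ) - (t : ℝ)| / lam - c ≤
        (X.dist (C (k + (s : ZMod n))) (C (k + (t : ZMod n))) : ℝ)

/-- A truncated `(lam, c)`-quasi-circle with major face `F` (of length `nF`) and
minor face `f` (of length `nf`): `F` is the initial part of a `(lam, c)`-quasi-circle
and `f` is a `(lam, c)`-quasi-geodesic with the same endpoints as the remaining part. -/
def IsTruncQuasiCircle {V : Type*} (X : SimpleGraph V) (lam c : ℝ)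
    (F : ℕ → V) (nF : ℕ) (f : ℕ → V) (nf : ℕ) : Prop :=
  (∀ i : ℕ, i < nF → X.Adj (F i) (F (i + 1))) ∧
  (∀ i : ℕ, i < nf → X.Adj (f i) (f (i + 1))) ∧
  f 0 = F nF ∧ f nf = F 0 ∧
  (∀ s t : ℕ, s ≤ nf → t ≤ nf →
    |(s : ℝ) - (t : ℝ)| / lam - c ≤ (X.dist (f s) (f t) : ℝ)) ∧
  ∃ (n : ℕ) (C : ZMod n → V), IsQuasiCircle X lam c n C ∧ nF ≤ n ∧
    ∀ i : ℕ, i ≤ nF → C (i : ZMod n) = F i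

/-- The graph `X`, with its graph metric, is quasi-isometric to the metric space `Y`. -/
def QIto {V : Type*} (X : SimpleGraph V) (Y : Type*) [PseudoMetricSpace Y] : Prop :=
  ∃ (lam c : ℝ) (f : V → Y), 1 ≤ lam ∧ 0 ≤ c ∧
    (∀ x x' : V, (X.dist x x' : ℝ) / lam - c ≤ dist (f x) (f x') ∧
      dist (f x) (f x') ≤ lam * (X.dist x x' : ℝ) + c) ∧
    ∀ y : Y, ∃ x : V, dist y (f x) ≤ c

/-- The Gromov product `(x · y)_w` in the graph metric. -/
noncomputable def gromovProd {V : Type*} (X : SimpleGraph V) (w x y : V) : ℝ :=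
  ((X.dist x w : ℝ) + (X.dist y w : ℝ) - (X.dist x y : ℝ)) / 2

/-- `X` is Gromov hyperbolic. -/
def GromovHyperbolic {V : Type*} (X : SimpleGraph V) : Prop :=
  ∃ δ : ℝ, 0 ≤ δ ∧ ∀ w x y z : V,
    min (gromovProd X w x z) (gromovProd X w y z) - δ ≤ gromovProd X w x y

/-- A connected infinite vertex-transitive locally finite graph, together with its closed
balls `B x r` as finsets and its growth function `f`. -/
structure HomogeneousBalls {V : Type*} (X : SimpleGraph V) (B : V → ℕ → Finset V)
    (f : ℕ → ℕ) : Prop where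
  infinite : Infinite V
  connected : X.Connected
  locallyFinite : ∀ v : V, (X.neighborSet v).Finite
  transitive : ∀ u v : V, ∃ φ : X ≃g X, φ u = v
  mem_iff : ∀ x y r, y ∈ B x r ↔ X.dist x y ≤ r
  card_eq : ∀ x r, (B x r).card = f r

section Basics

variable {V : Type*} {X : SimpleGraph V}

lemma dist_le_of_iso (hc : X.Connected) (φ : X ≃g X) (x y : V) :
    X.dist (φ x) (φ y) ≤ X.dist x y := by
  obtain ⟨p, hp⟩ := hc.exists_walk_length_eq_dist x y
  have h := dist_le (p.map φ.toHom)
  rw [Walk.length_map, hp] at h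
  exact h

lemma dist_iso (hc : X.Connected) (φ : X ≃g X) (x y : V) :
    X.dist (φ x) (φ y) = X.dist x y := by
  refine le_antisymm (dist_le_of_iso hc φ x y) ?_
  simpa using dist_le_of_iso hc φ.symm (φ x) (φ y)

/-- Along a walk from inside `A` to outside, some vertex lies in the outer boundary of `A`. -/
lemma exists_mem_boundary_of_walk {A : Set V} {x y : V} (p : X.Walk x y) (hx : x ∈ A)
    (hy : y ∉ A) : ∃ z ∈ vertexBoundary X A, z ∈ p.support := by
  obtain ⟨d, hd, h1, h2⟩ := p.exists_boundary_dart A hx hy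
  exact ⟨d.snd, ⟨h2, d.fst, h1, d.adj.symm⟩, p.dart_snd_mem_support_of_mem_darts hd⟩

/-- A vertex on a geodesic is at most as far from each endpoint as the other endpoint. -/
lemma dist_le_of_mem_geodesic {x y z : V} (p : X.Walk x y) (hp : p.length = X.dist x y)
    (hz : z ∈ p.support) : X.dist x z ≤ X.dist x y := by
  classical
  calc X.dist x z ≤ (p.takeUntil z hz).length := dist_le _
    _ ≤ p.length := p.length_takeUntil_le_length hz
    _ = _ := hp

lemma finite_closedBall (hc : X.Connected) (hlf : ∀ v : V, (X.neighborSet v).Finite)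
    (x : V) (r : ℕ) : {y : V | X.dist x y ≤ r}.Finite := by
  induction r with
  | zero =>
    refine (Set.finite_singleton x).subset fun y hy => ?_
    have h : X.dist x y = 0 := by simpa using hy
    exact (hc.dist_eq_zero_iff.1 h).symm
  | succ r ih =>
    refine (ih.union (ih.biUnion fun v _ => hlf v)).subset fun y hy => ?_
    obtain ⟨p, hp⟩ := hc.exists_walk_length_eq_dist y x
    rw [dist_comm] at hp
    cases p with
    | nil => exact Or.inl (by simp)
    | cons h q =>
      rename_i w
      refine Or.inr (Set.mem_biUnion (x := w) ?_ h.symm)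
      have h1 := dist_le q
      have hy' : X.dist x y ≤ r + 1 := hy
      rw [Walk.length_cons] at hp
      change X.dist x w ≤ r
      rw [dist_comm]
      omega

lemma finite_geodesics (hlf : ∀ v : V, (X.neighborSet v).Finite) (x y : V) :
    {p : X.Walk x y | p.length = X.dist x y}.Finite := by
  classical
  have : X.LocallyFinite := fun v => (hlf v).fintype
  rw [← X.coe_finsetWalkLength_eq]
  exact Finset.finite_toSet _

lemma exists_homogeneousBalls (hinf : Infinite V) (hc : X.Connected)
    (hlf : ∀ v : V, (X.neighborSet v).Finite)
    (htrans : ∀ u v : V, ∃ φ : X ≃g X, φ u = v) :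
    ∃ B f, HomogeneousBalls X B f := by
  classical
  obtain ⟨o⟩ := hc.nonempty
  refine ⟨fun x r => (finite_closedBall hc hlf x r).toFinset,
    fun r => (finite_closedBall hc hlf o r).toFinset.card, hinf, hc, hlf, htrans, ?_, ?_⟩
  · intro x y r
    simp
  · intro x r
    obtain ⟨φ, hφ⟩ := htrans x o
    refine Finset.card_bij (fun y _ => φ y) ?_ (fun _ _ _ _ h => φ.injective h) ?_
    · intro y hy
      simp only [Set.Finite.mem_toFinset, Set.mem_ofPred_eq] at hy ⊢
      rwa [← hφ, dist_iso hc]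
    · intro y hy
      refine ⟨φ.symm y, ?_, by simp⟩
      simp only [Set.Finite.mem_toFinset, Set.mem_ofPred_eq] at hy ⊢
      rw [← dist_iso hc φ, hφ]
      simpa using hy

lemma vertexBoundary_nonempty (hinf : Infinite V) (hc : X.Connected) {A : Set V}
    (hA : A.Finite) {a : V} (ha : a ∈ A) : (vertexBoundary X A).Nonempty := by
  obtain ⟨y, hy⟩ := hA.exists_notMem
  obtain ⟨p⟩ := hc a y
  obtain ⟨z, hz, -⟩ := exists_mem_boundary_of_walk p ha hy
  exact ⟨z, hz⟩

end Basics

namespace HomogeneousBalls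

variable {V : Type*} {X : SimpleGraph V} {B : V → ℕ → Finset V} {f : ℕ → ℕ}

lemma self_mem (H : HomogeneousBalls X B f) (x : V) (r : ℕ) : x ∈ B x r := by
  rw [H.mem_iff]; simp

lemma ball_mono (H : HomogeneousBalls X B f) (x : V) {r s : ℕ} (h : r ≤ s) : B x r ⊆ B x s := by
  intro y
  rw [H.mem_iff, H.mem_iff]
  omega

lemma mono (H : HomogeneousBalls X B f) : Monotone f := by
  intro r s h
  obtain ⟨o⟩ := H.connected.nonempty
  rw [← H.card_eq o, ← H.card_eq o]
  exact Finset.card_le_card (H.ball_mono o h)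

lemma pos (H : HomogeneousBalls X B f) (r : ℕ) : 1 ≤ f r := by
  obtain ⟨o⟩ := H.connected.nonempty
  rw [← H.card_eq o]
  exact Finset.card_pos.2 ⟨o, H.self_mem o r⟩

lemma finite_boundary (H : HomogeneousBalls X B f) {A : Set V} (hA : A.Finite) :
    (vertexBoundary X A).Finite := by
  refine (hA.biUnion fun v _ => H.locallyFinite v).subset ?_
  rintro y ⟨-, a, ha, h⟩
  exact Set.mem_biUnion ha h.symm

/-- A ball around `a` of radius less than the distance from `a` to the boundary of `A`
is contained in `A`. -/
lemma mem_of_dist_lt (H : HomogeneousBalls X B f) {A : Set V} {a y : V} {D : ℕ} (ha : a ∈ A)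
    (hD : ∀ b ∈ vertexBoundary X A, D ≤ X.dist a b) (hy : X.dist a y < D) : y ∈ A := by
  by_contra hyA
  obtain ⟨p, hp⟩ := H.connected.exists_walk_length_eq_dist a y
  obtain ⟨z, hz, hzp⟩ := exists_mem_boundary_of_walk p ha hyA
  have := hD z hz
  have := dist_le_of_mem_geodesic p hp hzp
  omega

/-- The sum of an invariant function over a ball does not depend on the centre. -/
lemma sum_ball_iso (H : HomogeneousBalls X B f) (q : V → V → ℝ)
    (hq : ∀ (φ : X ≃g X) x y, q (φ x) (φ y) = q x y) (R : ℕ) (x x' : V) :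
    ∑ y ∈ B x R, q x y = ∑ y ∈ B x' R, q x' y := by
  obtain ⟨φ, hφ⟩ := H.transitive x x'
  refine Finset.sum_bij (fun y _ => φ y) ?_ (fun _ _ _ _ h => φ.injective h) ?_ ?_
  · intro y hy
    rw [H.mem_iff] at hy ⊢
    rwa [← hφ, dist_iso H.connected]
  · intro y hy
    refine ⟨φ.symm y, ?_, by simp⟩
    rw [H.mem_iff] at hy ⊢
    rw [← dist_iso H.connected φ, hφ]
    simpa using hy
  · intro y _
    rw [← hφ, hq]

end HomogeneousBalls

/-- The mass transport inequality for finite-range invariant functions. -/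
def MassTransport {V : Type*} (X : SimpleGraph V) (B : V → ℕ → Finset V) : Prop :=
  ∀ (q : V → V → ℝ) (R : ℕ), (∀ x y, 0 ≤ q x y) →
    (∀ (φ : X ≃g X) x y, q (φ x) (φ y) = q x y) → (∀ x y, R < X.dist x y → q x y = 0) →
    ∀ x, ∑ y ∈ B x R, q y x ≤ ∑ y ∈ B x R, q x y

lemma sum_le_sum_of_forall_ne_zero_mem {ι : Type*} {s t : Finset ι} {g : ι → ℝ}
    (hg : ∀ i, 0 ≤ g i) (h : ∀ i ∈ s, g i ≠ 0 → i ∈ t) : ∑ i ∈ s, g i ≤ ∑ i ∈ t, g i := by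
  classical
  rw [← Finset.sum_filter_ne_zero s]
  refine Finset.sum_le_sum_of_subset_of_nonneg (fun i hi => ?_) fun i _ _ => hg i
  rw [Finset.mem_filter] at hi
  exact h i hi.1 hi.2

section Geodesics

variable {V : Type*} {X : SimpleGraph V}

/-- The number of geodesics from `x` to `y`. -/
noncomputable def geodesicCount (X : SimpleGraph V) (x y : V) : ℕ :=
  {p : X.Walk x y | p.length = X.dist x y}.ncard

/-- The number of geodesics from `x` to `y` through `z`. -/
noncomputable def geodesicCountThrough (X : SimpleGraph V) (x z y : V) : ℕ :=
  {p : X.Walk x y | p.length = X.dist x y ∧ z ∈ p.support}.ncard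

lemma finite_geodesics_through (hlf : ∀ v : V, (X.neighborSet v).Finite) (x z y : V) :
    {p : X.Walk x y | p.length = X.dist x y ∧ z ∈ p.support}.Finite :=
  (finite_geodesics hlf x y).subset fun _ h => h.1

lemma geodesicCount_pos (hc : X.Connected) (hlf : ∀ v : V, (X.neighborSet v).Finite) (x y : V) :
    0 < geodesicCount X x y := by
  obtain ⟨p, hp⟩ := hc.exists_walk_length_eq_dist x y
  exact (Set.ncard_pos (finite_geodesics hlf x y)).2 ⟨p, hp⟩

lemma geodesicCount_le_of_iso (hc : X.Connected) (hlf : ∀ v : V, (X.neighborSet v).Finite)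
    (φ : X ≃g X) (x y : V) : geodesicCount X x y ≤ geodesicCount X (φ x) (φ y) := by
  refine Set.ncard_le_ncard_of_injOn (fun p => p.map φ.toHom) ?_ ?_ (finite_geodesics hlf _ _)
  · intro p hp
    have hp' : p.length = X.dist x y := hp
    change (p.map φ.toHom).length = X.dist (φ x) (φ y)
    rw [Walk.length_map, dist_iso hc, hp']
  · intro p _ p' _ h
    exact Walk.map_injective_of_injective φ.injective x y h

lemma geodesicCountThrough_le_of_iso (hc : X.Connected)
    (hlf : ∀ v : V, (X.neighborSet v).Finite) (φ : X ≃g X) (x z y : V) :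
    geodesicCountThrough X x z y ≤ geodesicCountThrough X (φ x) (φ z) (φ y) := by
  refine Set.ncard_le_ncard_of_injOn (fun p => p.map φ.toHom) ?_ ?_
    (finite_geodesics_through hlf _ _ _)
  · intro p hp
    have hp' : p.length = X.dist x y ∧ z ∈ p.support := hp
    change (p.map φ.toHom).length = X.dist (φ x) (φ y) ∧ φ z ∈ (p.map φ.toHom).support
    refine ⟨by rw [Walk.length_map, dist_iso hc, hp'.1], ?_⟩
    rw [Walk.support_map]
    exact List.mem_map_of_mem hp'.2
  · intro p _ p' _ h
    exact Walk.map_injective_of_injective φ.injective x y h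

/-- The proportion of geodesics from `x` to `y` which pass through `z`. -/
noncomputable def geodesicDensity (X : SimpleGraph V) (x z y : V) : ℝ :=
  geodesicCountThrough X x z y / geodesicCount X x y

lemma geodesicDensity_nonneg (x z y : V) : 0 ≤ geodesicDensity X x z y := by
  unfold geodesicDensity
  positivity

lemma geodesicDensity_iso (hc : X.Connected) (hlf : ∀ v : V, (X.neighborSet v).Finite)
    (φ : X ≃g X) (x z y : V) :
    geodesicDensity X (φ x) (φ z) (φ y) = geodesicDensity X x z y := by
  have h1 : geodesicCount X (φ x) (φ y) = geodesicCount X x y :=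
    le_antisymm (by simpa using geodesicCount_le_of_iso hc hlf φ.symm (φ x) (φ y))
      (geodesicCount_le_of_iso hc hlf φ x y)
  have h2 : geodesicCountThrough X (φ x) (φ z) (φ y) = geodesicCountThrough X x z y :=
    le_antisymm (by simpa using geodesicCountThrough_le_of_iso hc hlf φ.symm (φ x) (φ z) (φ y))
      (geodesicCountThrough_le_of_iso hc hlf φ x z y)
  rw [geodesicDensity, geodesicDensity, h1, h2]

lemma geodesicDensity_eq_zero {x z y : V} (h : X.dist x y < X.dist x z) :
    geodesicDensity X x z y = 0 := by
  have : geodesicCountThrough X x z y = 0 := by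
    unfold geodesicCountThrough
    rw [Set.eq_empty_of_forall_notMem (s := {p : X.Walk x y | _}), Set.ncard_empty]
    rintro p ⟨hp, hz⟩
    have := dist_le_of_mem_geodesic p hp hz
    omega
  rw [geodesicDensity, this]
  simp

lemma geodesicCountThrough_eq_sum [DecidableEq V] (hlf : ∀ v : V, (X.neighborSet v).Finite)
    (x z y : V) : geodesicCountThrough X x z y =
      ∑ p ∈ (finite_geodesics hlf x y).toFinset, if z ∈ p.support then 1 else 0 := by
  rw [Finset.sum_boole, geodesicCountThrough, Nat.cast_id, ← Set.ncard_coe_finset]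
  congr 1
  ext p
  simp

lemma sum_geodesicDensity_le (hc : X.Connected) (hlf : ∀ v : V, (X.neighborSet v).Finite)
    (S : Finset V) (x y : V) : ∑ z ∈ S, geodesicDensity X x z y ≤ X.dist x y + 1 := by
  classical
  have hg : (0 : ℝ) < geodesicCount X x y := by exact_mod_cast geodesicCount_pos hc hlf x y
  simp only [geodesicDensity]
  rw [← Finset.sum_div, div_le_iff₀ hg]
  norm_cast
  simp only [geodesicCountThrough_eq_sum hlf]
  rw [Finset.sum_comm, geodesicCount, Set.ncard_eq_toFinset_card _ (finite_geodesics hlf x y),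
    mul_comm, ← smul_eq_mul]
  refine Finset.sum_le_card_nsmul _ _ _ fun p hp => ?_
  have hp' : p.length = X.dist x y := by simpa using hp
  rw [Finset.sum_boole, Nat.cast_id]
  calc (S.filter fun z => z ∈ p.support).card ≤ p.support.toFinset.card :=
        Finset.card_le_card fun z hz => by simpa using (Finset.mem_filter.1 hz).2
    _ ≤ p.support.length := List.toFinset_card_le _
    _ = X.dist x y + 1 := by rw [Walk.length_support, hp']

lemma one_le_sum_geodesicDensity (hc : X.Connected) (hlf : ∀ v : V, (X.neighborSet v).Finite)
    (S : Finset V) (x y : V)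
    (h : ∀ p : X.Walk x y, p.length = X.dist x y → ∃ z ∈ S, z ∈ p.support) :
    1 ≤ ∑ z ∈ S, geodesicDensity X x z y := by
  classical
  have hg : (0 : ℝ) < geodesicCount X x y := by exact_mod_cast geodesicCount_pos hc hlf x y
  simp only [geodesicDensity]
  rw [← Finset.sum_div, le_div_iff₀ hg, one_mul]
  norm_cast
  simp only [geodesicCountThrough_eq_sum hlf]
  rw [Finset.sum_comm, geodesicCount, Set.ncard_eq_toFinset_card _ (finite_geodesics hlf x y),
    Finset.card_eq_sum_ones]
  refine Finset.sum_le_sum fun p hp => ?_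
  obtain ⟨z, hz, hzp⟩ := h p (by simpa using hp)
  rw [Finset.sum_boole, Nat.cast_id]
  exact Finset.card_pos.2 ⟨z, Finset.mem_filter.2 ⟨hz, hzp⟩⟩

end Geodesics

namespace HomogeneousBalls

variable {V : Type*} {X : SimpleGraph V} {B : V → ℕ → Finset V} {f : ℕ → ℕ}

/-- If every geodesic joining a point `x` of `Ω` to a point of `Y x` meets `S`, then there are
at most `|S| (t + 1) f(t)` such pairs. -/
lemma card_pairs_le (H : HomogeneousBalls X B f) (hM : MassTransport X B) (t : ℕ)
    (Ω S : Finset V) (Y : V → Finset V) (ht : ∀ x ∈ Ω, ∀ y ∈ Y x, X.dist x y ≤ t)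
    (hS : ∀ x ∈ Ω, ∀ y ∈ Y x, ∀ p : X.Walk x y, p.length = X.dist x y →
      ∃ z ∈ S, z ∈ p.support) :
    ∑ x ∈ Ω, (Y x).card ≤ S.card * ((t + 1) * f t) := by
  have hc := H.connected
  have hlf := H.locallyFinite
  set q : V → V → ℝ := fun x z => ∑ y ∈ B x t, geodesicDensity X x z y with hq
  have hq0 : ∀ x z, 0 ≤ q x z := fun x z =>
    Finset.sum_nonneg fun y _ => geodesicDensity_nonneg x z y
  have hqinv : ∀ (φ : X ≃g X) x z, q (φ x) (φ z) = q x z := by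
    intro φ x z
    symm
    refine Finset.sum_bij (fun y _ => φ y) ?_ (fun _ _ _ _ h => φ.injective h) ?_ ?_
    · intro y hy
      rw [H.mem_iff] at hy ⊢
      rwa [dist_iso hc]
    · intro y hy
      refine ⟨φ.symm y, ?_, by simp⟩
      rw [H.mem_iff] at hy ⊢
      rw [← dist_iso hc φ]
      simpa using hy
    · intro y _
      rw [geodesicDensity_iso hc hlf]
  have hqsupp : ∀ x z, t < X.dist x z → q x z = 0 := by
    intro x z hxz
    refine Finset.sum_eq_zero fun y hy => geodesicDensity_eq_zero ?_
    rw [H.mem_iff] at hy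
    omega
  have hout : ∀ z, ∑ x ∈ B z t, q z x ≤ (t + 1) * f t := by
    intro z
    simp only [hq]
    rw [Finset.sum_comm]
    calc ∑ y ∈ B z t, ∑ x ∈ B z t, geodesicDensity X z x y
        ≤ ∑ _y ∈ B z t, ((t : ℝ) + 1) := by
          refine Finset.sum_le_sum fun y hy => ?_
          refine (sum_geodesicDensity_le hc hlf _ z y).trans ?_
          rw [H.mem_iff] at hy
          have : (X.dist z y : ℝ) ≤ t := by exact_mod_cast hy
          linarith
      _ = (t + 1) * f t := by
          rw [Finset.sum_const, H.card_eq, nsmul_eq_mul, mul_comm]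
  have key : ((∑ x ∈ Ω, (Y x).card : ℕ) : ℝ) ≤ S.card * ((t + 1) * f t) := by
    calc ((∑ x ∈ Ω, (Y x).card : ℕ) : ℝ) = ∑ x ∈ Ω, ∑ _y ∈ Y x, (1 : ℝ) := by simp
      _ ≤ ∑ x ∈ Ω, ∑ y ∈ Y x, ∑ z ∈ S, geodesicDensity X x z y :=
          Finset.sum_le_sum fun x hx => Finset.sum_le_sum fun y hy =>
            one_le_sum_geodesicDensity hc hlf S x y (hS x hx y hy)
      _ ≤ ∑ x ∈ Ω, ∑ y ∈ B x t, ∑ z ∈ S, geodesicDensity X x z y :=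
          Finset.sum_le_sum fun x hx => Finset.sum_le_sum_of_subset_of_nonneg
            (fun y hy => (H.mem_iff _ _ _).2 (ht x hx y hy))
            fun y _ _ => Finset.sum_nonneg fun z _ => geodesicDensity_nonneg x z y
      _ = ∑ z ∈ S, ∑ x ∈ Ω, q x z := by
          rw [Finset.sum_comm (s := S)]
          exact Finset.sum_congr rfl fun x _ => Finset.sum_comm
      _ ≤ ∑ z ∈ S, ∑ x ∈ B z t, q x z := by
          refine Finset.sum_le_sum fun z _ =>
            sum_le_sum_of_forall_ne_zero_mem (fun x => hq0 x z) fun x _ hx => ?_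
          rw [H.mem_iff, dist_comm]
          by_contra hlt
          exact hx (hqsupp x z (not_le.1 hlt))
      _ ≤ ∑ _z ∈ S, ((t : ℝ) + 1) * f t :=
          Finset.sum_le_sum fun z _ => (hM q t hq0 hqinv hqsupp z).trans (hout z)
      _ = S.card * ((t + 1) * f t) := by rw [Finset.sum_const, nsmul_eq_mul]
  exact_mod_cast key

/-- The isoperimetric inequality of Coulhon and Saloff-Coste. -/
lemma card_le_of_massTransport (H : HomogeneousBalls X B f) (hM : MassTransport X B) {t : ℕ}
    (ht : 1 ≤ t) (Ω S : Finset V) (hS : vertexBoundary X (Ω : Set V) ⊆ S)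
    (hΩ : 2 * Ω.card ≤ f t) : Ω.card ≤ 4 * t * S.card := by
  classical
  have h := H.card_pairs_le hM t Ω S (fun x => B x t \ Ω)
    (fun x _ y hy => (H.mem_iff _ _ _).1 (Finset.mem_sdiff.1 hy).1) (by
      intro x hx y hy p _
      obtain ⟨z, hz, hzp⟩ := exists_mem_boundary_of_walk (A := (Ω : Set V)) p hx
        (by simpa using (Finset.mem_sdiff.1 hy).2)
      exact ⟨z, by simpa using hS hz, hzp⟩)
  have h2 : ∀ x ∈ Ω, f t ≤ 2 * (B x t \ Ω).card := by
    intro x _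
    have := Finset.le_card_sdiff Ω (B x t)
    rw [H.card_eq] at this
    omega
  have h3 : Ω.card * f t ≤ 2 * ∑ x ∈ Ω, (B x t \ Ω).card := by
    rw [Finset.mul_sum, ← smul_eq_mul]
    exact Finset.card_nsmul_le_sum _ _ _ h2
  have h4 : Ω.card * f t ≤ (4 * t * S.card) * f t := by
    calc Ω.card * f t ≤ 2 * (S.card * ((t + 1) * f t)) := by omega
      _ = (2 * (t + 1) * S.card) * f t := by ring
      _ ≤ (4 * t * S.card) * f t :=
          Nat.mul_le_mul_right _ (Nat.mul_le_mul_right _ (by omega))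
  exact Nat.le_of_mul_le_mul_right h4 (H.pos t)

/-- If mass transport fails, the graph is non-amenable. -/
lemma exists_card_le_of_not_massTransport (H : HomogeneousBalls X B f)
    (hM : ¬ MassTransport X B) :
    ∃ κ : ℕ, 1 ≤ κ ∧ ∀ Ω S : Finset V, vertexBoundary X (Ω : Set V) ⊆ S →
      Ω.card ≤ κ * S.card := by
  classical
  unfold MassTransport at hM
  push Not at hM
  obtain ⟨q, R, hq0, hqinv, hqsupp, o, ho⟩ := hM
  set out := ∑ y ∈ B o R, q o y with hout
  set inn := ∑ y ∈ B o R, q y o with hinn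
  have hout0 : 0 ≤ out := Finset.sum_nonneg fun y _ => hq0 _ _
  have hbase : ∀ Ω S : Finset V, vertexBoundary X (Ω : Set V) ⊆ S →
      (Ω.card : ℝ) * inn ≤ (Ω.card + S.card * f R) * out := by
    intro Ω S hS
    have hcover : ∀ z ∈ Ω, ∀ x ∈ B z R, x ∈ Ω ∪ S.biUnion fun b => B b R := by
      intro z hz x hx
      rw [H.mem_iff] at hx
      by_cases hxΩ : x ∈ Ω
      · exact Finset.mem_union_left _ hxΩ
      · obtain ⟨p, hp⟩ := H.connected.exists_walk_length_eq_dist x z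
        obtain ⟨b, hb, hbp⟩ := exists_mem_boundary_of_walk (A := (Ω : Set V)) p.reverse hz
          (by simpa using hxΩ)
        refine Finset.mem_union_right _ (Finset.mem_biUnion.2 ⟨b, by simpa using hS hb, ?_⟩)
        rw [H.mem_iff, dist_comm]
        have := dist_le_of_mem_geodesic p hp (z := b) (by simpa using hbp)
        rw [dist_comm] at hx
        omega
    have hcard : ((Ω ∪ S.biUnion fun b => B b R).card : ℝ) ≤ Ω.card + S.card * f R := by
      have h1 := Finset.card_union_le Ω (S.biUnion fun b => B b R)
      have h2 : (S.biUnion fun b => B b R).card ≤ S.card * f R :=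
        Finset.card_biUnion_le_card_mul _ _ _ fun b _ => (H.card_eq b R).le
      exact_mod_cast h1.trans (by omega)
    calc (Ω.card : ℝ) * inn = ∑ z ∈ Ω, ∑ x ∈ B z R, q x z := by
          rw [Finset.sum_congr rfl fun z _ =>
            H.sum_ball_iso (fun x y => q y x) (fun φ x y => hqinv φ y x) R z o,
            Finset.sum_const, nsmul_eq_mul]
      _ ≤ ∑ z ∈ Ω, ∑ x ∈ Ω ∪ S.biUnion fun b => B b R, q x z :=
          Finset.sum_le_sum fun z hz => Finset.sum_le_sum_of_subset_of_nonneg (hcover z hz)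
            fun x _ _ => hq0 _ _
      _ = ∑ x ∈ Ω ∪ S.biUnion fun b => B b R, ∑ z ∈ Ω, q x z := Finset.sum_comm
      _ ≤ ∑ x ∈ Ω ∪ S.biUnion fun b => B b R, ∑ z ∈ B x R, q x z := by
          refine Finset.sum_le_sum fun x _ =>
            sum_le_sum_of_forall_ne_zero_mem (fun z => hq0 x z) fun z _ hz => ?_
          rw [H.mem_iff]
          by_contra hlt
          exact hz (hqsupp x z (not_le.1 hlt))
      _ = ((Ω ∪ S.biUnion fun b => B b R).card : ℝ) * out := by
          rw [Finset.sum_congr rfl fun x _ => H.sum_ball_iso q hqinv R x o,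
            Finset.sum_const, nsmul_eq_mul]
      _ ≤ _ := by gcongr
  have hpos : 0 < inn - out := by linarith
  obtain ⟨κ, hκ⟩ := exists_nat_ge (f R * out / (inn - out))
  refine ⟨κ + 1, by omega, fun Ω S hS => ?_⟩
  have h := hbase Ω S hS
  have h1 : (Ω.card : ℝ) * (inn - out) ≤ S.card * (f R * out) := by linarith
  have h2 : (Ω.card : ℝ) ≤ S.card * (f R * out / (inn - out)) := by
    rw [mul_div_assoc', le_div_iff₀ hpos]
    exact h1
  have h3 : (Ω.card : ℝ) ≤ (κ + 1 : ℕ) * S.card := by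
    calc (Ω.card : ℝ) ≤ S.card * κ := h2.trans (by gcongr)
      _ ≤ (κ + 1 : ℕ) * S.card := by
        push_cast
        nlinarith [Nat.cast_nonneg (α := ℝ) S.card]
  exact_mod_cast h3

end HomogeneousBalls

/-- `D`-separated subsets of `S` in balls of radius `s ≥ D` have at most `K s / D` elements. -/
def LinearlySpread {V : Type*} (X : SimpleGraph V) (S : Set V) (K : ℕ) : Prop :=
  ∀ (x : V) (s D : ℕ) (Z : Finset V), 1 ≤ D → D ≤ s → (∀ z ∈ Z, z ∈ S ∧ X.dist x z ≤ s) →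
    (∀ z ∈ Z, ∀ z' ∈ Z, z ≠ z' → D ≤ X.dist z z') → Z.card * D ≤ K * s

lemma two_pow_mul_le_of_growth {u : ℕ → ℕ} {N m s₀ : ℕ} (hN : 1 ≤ N)
    (h : ∀ s, s₀ ≤ s → s < s₀ + N * m → (N + 1) * u s ≤ N * u (s + 1)) :
    2 ^ m * u s₀ ≤ u (s₀ + N * m) := by
  have h1 : ∀ j, j ≤ N * m → (N + 1) ^ j * u s₀ ≤ N ^ j * u (s₀ + j) := by
    intro j
    induction j with
    | zero => simp
    | succ j ih =>
      intro hj
      have h2 := ih (by omega)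
      have h3 := h (s₀ + j) (by omega) (by omega)
      calc (N + 1) ^ (j + 1) * u s₀ = (N + 1) * ((N + 1) ^ j * u s₀) := by ring
        _ ≤ (N + 1) * (N ^ j * u (s₀ + j)) := by gcongr
        _ = N ^ j * ((N + 1) * u (s₀ + j)) := by ring
        _ ≤ N ^ j * (N * u (s₀ + j + 1)) := by gcongr
        _ = N ^ (j + 1) * u (s₀ + (j + 1)) := by ring_nf
  have h2 : 2 * N ^ N ≤ (N + 1) ^ N := by
    have hN' : (0 : ℝ) < N := by exact_mod_cast hN
    have h3 := one_add_mul_le_pow (a := (1 / N : ℝ)) (by linarith [one_div_pos.2 hN']) N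
    have h4 : (1 + 1 / N : ℝ) ^ N * (N : ℝ) ^ N = (N + 1 : ℝ) ^ N := by
      rw [← mul_pow]
      congr 1
      field_simp
    have h5 : (2 : ℝ) * (N : ℝ) ^ N ≤ (N + 1 : ℝ) ^ N := by
      rw [← h4]
      refine mul_le_mul_of_nonneg_right (le_trans (le_of_eq ?_) h3) (by positivity)
      field_simp
      norm_num
    exact_mod_cast h5
  have h3 := h1 (N * m) le_rfl
  have h4 : N ^ (N * m) * (2 ^ m * u s₀) ≤ N ^ (N * m) * u (s₀ + N * m) := by
    calc N ^ (N * m) * (2 ^ m * u s₀) = (2 * N ^ N) ^ m * u s₀ := by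
          rw [mul_pow, ← pow_mul]; ring
      _ ≤ ((N + 1) ^ N) ^ m * u s₀ := by gcongr
      _ = (N + 1) ^ (N * m) * u s₀ := by rw [← pow_mul]
      _ ≤ _ := h3
  exact Nat.le_of_mul_le_mul_left h4 (by positivity)

lemma exists_four_pow_gt (K κ : ℕ) : ∃ k, 1 ≤ k ∧ 2 * K * (3 + 12 * κ * k * 3 ^ k) < 4 ^ k := by
  have h1 := tendsto_pow_const_mul_const_pow_of_abs_lt_one 1 (r := (3 / 4 : ℝ))
    (by rw [abs_lt]; constructor <;> norm_num)
  have hpos : (0 : ℝ) < 1 / (2 * K * (3 + 12 * κ) + 1) := by positivity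
  obtain ⟨k, hk, hk1⟩ := ((h1.eventually (gt_mem_nhds hpos)).and
    (Filter.eventually_ge_atTop 1)).exists
  refine ⟨k, hk1, ?_⟩
  rw [lt_div_iff₀ (by positivity), pow_one, div_pow] at hk
  have h4 : (0 : ℝ) < 4 ^ k := by positivity
  have h2 : (k : ℝ) * 3 ^ k * (2 * K * (3 + 12 * κ) + 1) < 4 ^ k := by
    have := mul_lt_mul_of_pos_right hk h4
    rw [one_mul] at this
    refine lt_of_le_of_lt (le_of_eq ?_) this
    field_simp
  have h3 : k * 3 ^ k * (2 * K * (3 + 12 * κ) + 1) < 4 ^ k := by exact_mod_cast h2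
  have h5 : 1 ≤ k * 3 ^ k := Nat.mul_pos hk1 (by positivity)
  refine lt_of_le_of_lt ?_ h3
  calc 2 * K * (3 + 12 * κ * k * 3 ^ k) ≤ 2 * K * (3 * (k * 3 ^ k) + 12 * κ * k * 3 ^ k) := by
        gcongr; omega
    _ = k * 3 ^ k * (2 * K * (3 + 12 * κ)) := by ring
    _ ≤ _ := by gcongr; omega

lemma exists_mul_sq_le_of_cubic_growth {f : ℕ → ℕ} (hf : Monotone f) (hf1 : ∀ r, 1 ≤ f r)
    {r₁ : ℕ} (hr₁ : 1 ≤ r₁) (h : ∀ r, r₁ ≤ r → 27 * f r ≤ f (3 * r)) (E : ℕ) :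
    ∃ n₀, ∀ n, n₀ ≤ n → E * (n + 1) ^ 2 ≤ f n := by
  have h1 : ∀ j, 27 ^ j ≤ f (3 ^ j * r₁) := by
    intro j
    induction j with
    | zero => simpa using hf1 r₁
    | succ j ih =>
      have := h (3 ^ j * r₁) (Nat.le_mul_of_pos_left _ (by positivity))
      calc 27 ^ (j + 1) = 27 * 27 ^ j := by ring
        _ ≤ 27 * f (3 ^ j * r₁) := by gcongr
        _ ≤ _ := this
        _ = f (3 ^ (j + 1) * r₁) := by ring_nf
  obtain ⟨j₀, hj₀⟩ := pow_unbounded_of_one_lt (E * (9 * r₁ ^ 2)) (by norm_num : 1 < 3)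
  refine ⟨3 ^ j₀ * r₁, fun n hn => ?_⟩
  have hn1 : 3 ^ j₀ ≤ n / r₁ := (Nat.le_div_iff_mul_le hr₁).2 hn
  set j := Nat.log 3 (n / r₁) with hj
  have hpos : n / r₁ ≠ 0 := by have := Nat.one_le_pow j₀ 3 (by norm_num); omega
  have hjj : j₀ ≤ j := Nat.le_log_of_pow_le (by norm_num) hn1
  have h2 : 3 ^ j * r₁ ≤ n := (Nat.le_div_iff_mul_le hr₁).1 (Nat.pow_log_le_self 3 hpos)
  have h3 : n + 1 ≤ 3 ^ (j + 1) * r₁ :=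
    (Nat.div_lt_iff_lt_mul hr₁).1 (Nat.lt_pow_succ_log_self (by norm_num) _)
  calc E * (n + 1) ^ 2 ≤ E * (3 ^ (j + 1) * r₁) ^ 2 := by gcongr
    _ = E * (9 * r₁ ^ 2) * 9 ^ j := by
      rw [show (9 : ℕ) = 3 ^ 2 by norm_num, ← pow_mul]; ring
    _ ≤ 3 ^ j * 9 ^ j := by
      gcongr
      exact hj₀.le.trans (Nat.pow_le_pow_right (by norm_num) hjj)
    _ = 27 ^ j := by rw [← mul_pow]; norm_num
    _ ≤ f (3 ^ j * r₁) := h1 j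
    _ ≤ f n := hf h2

namespace HomogeneousBalls

variable {V : Type*} {X : SimpleGraph V} {B : V → ℕ → Finset V} {f : ℕ → ℕ}

lemma card_boundary_inter_le (H : HomogeneousBalls X B f) {S : Set V} {K : ℕ}
    (hS : LinearlySpread X S K) (x : V) {s : ℕ} (hs : 1 ≤ s) (Z : Finset V)
    (hZ : ∀ z ∈ Z, z ∈ S ∧ X.dist x z ≤ s) : Z.card ≤ K * s := by
  have := hS x s 1 Z le_rfl hs hZ fun z _ z' _ h => H.connected.pos_dist_of_ne h
  omega

/-- At a doubling scale of large volume, a linearly spread set cannot bound a finite set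
containing a ball of this scale. -/
lemma false_of_doubling (H : HomogeneousBalls X B f) (hM : MassTransport X B) {K r : ℕ}
    (hr : 1 ≤ r) (hf : 1728 * K * r ^ 2 < f r) (hd : f (3 * r) ≤ 27 * f r) (A : Finset V)
    (hA : LinearlySpread X (vertexBoundary X (A : Set V)) K) {a : V}
    (ha : ∀ y, X.dist a y ≤ r → y ∈ A) : False := by
  classical
  have hc := H.connected
  have haA : a ∈ A := ha a (by simp)
  obtain ⟨y, hy⟩ : ∃ y, y ∉ A.biUnion fun b => B b r :=
    have := H.infinite
    Infinite.exists_notMem_finset _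
  obtain ⟨p⟩ := hc a y
  have hstart : a ∈ {x : V | f r ≤ 2 * (A ∩ B x r).card} := by
    have : A ∩ B a r = B a r :=
      Finset.inter_eq_right.2 fun z hz => ha z ((H.mem_iff _ _ _).1 hz)
    change f r ≤ 2 * (A ∩ B a r).card
    rw [this, H.card_eq]
    omega
  have hend : y ∉ {x : V | f r ≤ 2 * (A ∩ B x r).card} := by
    have h0 : A ∩ B y r = ∅ := by
      refine Finset.eq_empty_of_forall_notMem fun z hz => hy ?_
      rw [Finset.mem_inter, H.mem_iff, SimpleGraph.dist_comm] at hz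
      exact Finset.mem_biUnion.2 ⟨z, hz.1, (H.mem_iff _ _ _).2 hz.2⟩
    change ¬ f r ≤ 2 * (A ∩ B y r).card
    rw [h0]
    have := H.pos r
    simp
    omega
  obtain ⟨d, -, h1, h2⟩ := p.exists_boundary_dart _ hstart hend
  obtain ⟨⟨x, x'⟩, hadj⟩ := d
  change f r ≤ 2 * (A ∩ B x r).card at h1
  change ¬ f r ≤ 2 * (A ∩ B x' r).card at h2
  have hxx' : X.dist x x' = 1 := dist_eq_one_iff_adj.2 hadj
  have h3 : f r ≤ 2 * (B x' r \ A).card := by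
    have h4 := Finset.card_sdiff_add_card_inter (B x' r) A
    rw [H.card_eq, Finset.inter_comm] at h4
    omega
  set S := (H.finite_boundary A.finite_toSet).toFinset ∩ B x (4 * r) with hSdef
  have hScard : S.card ≤ K * (4 * r) := by
    refine H.card_boundary_inter_le hA x (by omega) S fun z hz => ?_
    rw [hSdef, Finset.mem_inter, H.mem_iff, Set.Finite.mem_toFinset] at hz
    exact hz
  have hdist : ∀ u ∈ A ∩ B x r, ∀ w ∈ B x' r \ A, X.dist u w ≤ 3 * r := by
    intro u hu w hw
    rw [Finset.mem_inter, H.mem_iff, SimpleGraph.dist_comm] at hu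
    rw [Finset.mem_sdiff, H.mem_iff] at hw
    have := hc.dist_triangle (u := u) (v := x) (w := w)
    have := hc.dist_triangle (u := x) (v := x') (w := w)
    omega
  have hpairs := H.card_pairs_le hM (3 * r) (A ∩ B x r) S (fun _ => B x' r \ A) hdist (by
    intro u hu w hw p hp
    have hu' := hu
    rw [Finset.mem_inter, H.mem_iff] at hu'
    obtain ⟨z, hz, hzp⟩ := exists_mem_boundary_of_walk (A := (A : Set V)) p hu'.1
      (by simpa using (Finset.mem_sdiff.1 hw).2)
    refine ⟨z, ?_, hzp⟩
    rw [hSdef, Finset.mem_inter, H.mem_iff, Set.Finite.mem_toFinset]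
    refine ⟨hz, ?_⟩
    have := dist_le_of_mem_geodesic p hp hzp
    have := hdist u hu w hw
    have := hc.dist_triangle (u := x) (v := u) (w := z)
    omega)
  rw [Finset.sum_const, smul_eq_mul] at hpairs
  have h5 : f r * f r ≤ (1728 * K * r ^ 2) * f r := by
    calc f r * f r ≤ (2 * (A ∩ B x r).card) * (2 * (B x' r \ A).card) := by gcongr
      _ = 4 * ((A ∩ B x r).card * (B x' r \ A).card) := by ring
      _ ≤ 4 * ((K * (4 * r)) * ((3 * r + r) * (27 * f r))) := by
        refine Nat.mul_le_mul_left _ (hpairs.trans ?_)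
        gcongr
      _ = (1728 * K * r ^ 2) * f r := by ring
  have := Nat.le_of_mul_le_mul_right h5 (H.pos r)
  omega

/-- In a linearly bounded finite set all of whose points are within `D` of the boundary, volumes
grow linearly beyond scale `D`. -/
lemma card_inter_ball_le (H : HomogeneousBalls X B f) [DecidableEq V] {K D W : ℕ} (hD : 1 ≤ D)
    (A : Finset V)
    (hA : LinearlySpread X (vertexBoundary X (A : Set V)) K)
    (hdeep : ∀ a ∈ A, ∃ b ∈ vertexBoundary X (A : Set V), X.dist a b ≤ D)
    (hW : ∀ x ∈ A, (A ∩ B x (3 * D)).card ≤ W) (x : V) {s : ℕ} (hs : D ≤ s) :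
    (A ∩ B x s).card * D ≤ 2 * K * s * W := by
  classical
  have hc := H.connected
  let P : Finset V → Prop := fun Z =>
    ∀ z ∈ Z, ∀ z' ∈ Z, z ≠ z' → 3 * D < X.dist z z'
  obtain ⟨Z, hZ, hmax⟩ := Finset.exists_max_image
    ((A ∩ B x s).powerset.filter P) Finset.card
    ⟨∅, Finset.mem_filter.2 ⟨Finset.empty_mem_powerset _, fun z hz =>
      absurd hz (Finset.notMem_empty z)⟩⟩
  rw [Finset.mem_filter, Finset.mem_powerset] at hZ
  obtain ⟨hZs, hZP⟩ := hZ
  have hcover : A ∩ B x s ⊆ Z.biUnion fun z => A ∩ B z (3 * D) := by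
    intro y hy
    by_contra hcon
    have hfar : ∀ z ∈ Z, 3 * D < X.dist z y := by
      intro z hz
      by_contra hle
      exact hcon (Finset.mem_biUnion.2 ⟨z, hz, Finset.mem_inter.2
        ⟨(Finset.mem_inter.1 hy).1, (H.mem_iff _ _ _).2 (not_lt.1 hle)⟩⟩)
    have hyZ : y ∉ Z := fun h => by simpa using hfar y h
    have := hmax (insert y Z) (by
      rw [Finset.mem_filter, Finset.mem_powerset]
      refine ⟨Finset.insert_subset hy hZs, ?_⟩
      intro z hz z' hz' hne
      rw [Finset.mem_insert] at hz hz'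
      rcases hz with rfl | hz <;> rcases hz' with rfl | hz'
      · exact absurd rfl hne
      · rw [SimpleGraph.dist_comm]; exact hfar z' hz'
      · exact hfar z hz
      · exact hZP z hz z' hz' hne)
    rw [Finset.card_insert_of_notMem hyZ] at this
    omega
  have hZA : ∀ z ∈ Z, z ∈ A ∧ X.dist x z ≤ s := fun z hz => by
    have := hZs hz
    rwa [Finset.mem_inter, H.mem_iff] at this
  have h1 : (A ∩ B x s).card ≤ Z.card * W :=
    (Finset.card_le_card hcover).trans
      (Finset.card_biUnion_le_card_mul _ _ _ fun z hz => hW z (hZA z hz).1)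
  choose! b hb hbD using hdeep
  have hsep : ∀ z ∈ Z, ∀ z' ∈ Z, z ≠ z' → D ≤ X.dist (b z) (b z') := by
    intro z hz z' hz' hne
    have h3 := hZP z hz z' hz' hne
    have h4 := hbD z (hZA z hz).1
    have h5 := hbD z' (hZA z' hz').1
    rw [SimpleGraph.dist_comm] at h5
    have := hc.dist_triangle (u := z) (v := b z) (w := z')
    have := hc.dist_triangle (u := b z) (v := b z') (w := z')
    omega
  have hinj : Set.InjOn b Z := by
    intro z hz z' hz' h
    by_contra hne
    have := hsep z hz z' hz' hne
    rw [h, SimpleGraph.dist_self] at this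
    omega
  have h2 : Z.card * D ≤ K * (s + D) := by
    rw [← Finset.card_image_of_injOn hinj]
    refine hA x (s + D) D (Z.image b) hD (by omega) ?_ ?_
    · intro y hy
      obtain ⟨z, hz, rfl⟩ := Finset.mem_image.1 hy
      refine ⟨hb z (hZA z hz).1, ?_⟩
      have := hc.dist_triangle (u := x) (v := z) (w := b z)
      have := (hZA z hz).2
      have := hbD z (hZA z hz).1
      omega
    · intro y hy y' hy' hne
      obtain ⟨z, hz, rfl⟩ := Finset.mem_image.1 hy
      obtain ⟨z', hz', rfl⟩ := Finset.mem_image.1 hy'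
      exact hsep z hz z' hz' fun h => hne (by rw [h])
  calc (A ∩ B x s).card * D ≤ Z.card * W * D := by gcongr
    _ = Z.card * D * W := by ring
    _ ≤ K * (s + s) * W := Nat.mul_le_mul_right _
        (h2.trans (Nat.mul_le_mul_left _ (by omega)))
    _ = 2 * K * s * W := by ring

end HomogeneousBalls

namespace HomogeneousBalls

variable {V : Type*} {X : SimpleGraph V} {B : V → ℕ → Finset V} {f : ℕ → ℕ}

/-- If volumes grow at least cubically and small finite sets satisfy an isoperimetric inequality,
then finite sets with linearly spread boundary have bounded depth. -/
lemma exists_forall_dist_le (H : HomogeneousBalls X B f) {κ r₁ : ℕ} (hr₁ : 1 ≤ r₁)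
    (hG : ∀ r, r₁ ≤ r → 27 * f r ≤ f (3 * r)) (hκ : 1 ≤ κ)
    (hI : ∀ (Ω S : Finset V) (t : ℕ), 1 ≤ t → vertexBoundary X (Ω : Set V) ⊆ S →
      2 * Ω.card ≤ f t → Ω.card ≤ κ * t * S.card) (K : ℕ) :
    ∃ C₀ : ℕ, ∀ A : Finset V, LinearlySpread X (vertexBoundary X (A : Set V)) K →
      ∀ a ∈ A, ∃ b ∈ vertexBoundary X (A : Set V), X.dist a b ≤ C₀ := by
  classical
  have hc := H.connected
  obtain ⟨k, hk, hk4⟩ := exists_four_pow_gt K κ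
  set L := 12 * κ * k * 3 ^ k with hL
  obtain ⟨n₀, hn₀⟩ := exists_mul_sq_le_of_cubic_growth H.mono H.pos hr₁ hG
    (2 * κ * 3 ^ (k + 1) * K * (4 + L) + 1)
  refine ⟨n₀ + r₁, fun A hA a ha => ?_⟩
  by_contra hcon
  push Not at hcon
  have hbd : ∀ y ∈ A, ∃ b ∈ vertexBoundary X (A : Set V),
      ∀ b' ∈ vertexBoundary X (A : Set V), X.dist y b ≤ X.dist y b' := by
    intro y _
    obtain ⟨b, hb, hmin⟩ := (H.finite_boundary A.finite_toSet).toFinset.exists_min_image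
      (X.dist y) ((Set.Finite.toFinset_nonempty _).2
        (vertexBoundary_nonempty H.infinite hc A.finite_toSet ha))
    refine ⟨b, (Set.Finite.mem_toFinset _).1 hb, fun b' hb' => hmin b' ?_⟩
    exact (Set.Finite.mem_toFinset _).2 hb'
  choose! b hb hbmin using hbd
  obtain ⟨a₀, ha₀, hmax⟩ := A.exists_max_image (fun y => X.dist y (b y)) ⟨a, ha⟩
  set D := X.dist a₀ (b a₀) with hDdef
  have hDC : n₀ + r₁ < D := (hcon _ (hb a ha)).trans_le (hmax a ha)
  have hdeep : ∀ y ∈ A, ∃ z ∈ vertexBoundary X (A : Set V), X.dist y z ≤ D :=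
    fun y hy => ⟨b y, hb y hy, hmax y hy⟩
  obtain ⟨x, hx, hWmax⟩ := A.exists_max_image (fun y => (A ∩ B y (3 * D)).card) ⟨a, ha⟩
  set v : ℕ → ℕ := fun s => (A ∩ B x s).card with hv
  set W := v (3 * D) with hWdef
  have hWlow : (2 * κ * 3 ^ (k + 1) * K * (4 + L) + 1) * D ^ 2 ≤ W := by
    have h1 := hn₀ (D - 1) (by omega)
    rw [show D - 1 + 1 = D by omega] at h1
    refine h1.trans (le_trans ?_ (hWmax a₀ ha₀))
    rw [← H.card_eq a₀ (D - 1)]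
    refine Finset.card_le_card fun y hy => ?_
    have hy' := (H.mem_iff _ _ _).1 hy
    exact Finset.mem_inter.2 ⟨H.mem_of_dist_lt (A := (A : Set V)) (D := D) ha₀
      (hbmin a₀ ha₀) (by omega), (H.mem_iff _ _ _).2 (by omega)⟩
  have hWpos : 0 < W := lt_of_lt_of_le (by have : 0 < D := by omega
                                           positivity) hWlow
  have hvmono : ∀ s s', s ≤ s' → v s ≤ v s' := fun s s' h =>
    Finset.card_le_card (Finset.inter_subset_inter_left (H.ball_mono x h))
  have hvle : ∀ s, 3 * D ≤ s → s ≤ (3 + L) * D → v s < 4 ^ k * W := by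
    intro s hs hs'
    have h1 := H.card_inter_ball_le (by omega : 1 ≤ D) A hA hdeep hWmax x (by omega : D ≤ s)
    have h2 : v s * D ≤ (2 * K * (3 + L) * W) * D := by
      calc v s * D ≤ 2 * K * s * W := h1
        _ ≤ 2 * K * ((3 + L) * D) * W := by gcongr
        _ = _ := by ring
    exact (Nat.le_of_mul_le_mul_right h2 (by omega)).trans_lt
      (Nat.mul_lt_mul_of_pos_right hk4 hWpos)
  have hft : 27 ^ k * W ≤ f (3 ^ k * (3 * D)) := by
    have h1 : ∀ j, 27 ^ j * W ≤ f (3 ^ j * (3 * D)) := by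
      intro j
      induction j with
      | zero =>
        rw [pow_zero, pow_zero, one_mul, one_mul, ← H.card_eq x]
        exact Finset.card_le_card Finset.inter_subset_right
      | succ j ih =>
        have h2 := hG (3 ^ j * (3 * D)) (by
          have := Nat.le_mul_of_pos_left (3 * D) (show 0 < 3 ^ j by positivity)
          omega)
        calc 27 ^ (j + 1) * W = 27 * (27 ^ j * W) := by ring
          _ ≤ 27 * f (3 ^ j * (3 * D)) := by gcongr
          _ ≤ _ := h2
          _ = _ := by ring_nf
    exact h1 k
  set t := 3 ^ k * (3 * D) with ht
  have htpos : 1 ≤ t := Nat.mul_pos (by positivity) (by omega)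
  have hlen : 3 * D + 2 * κ * t * (2 * k) = (3 + L) * D := by rw [ht, hL]; ring
  have hstep : ∀ s, 3 * D ≤ s → s < 3 * D + 2 * κ * t * (2 * k) →
      (2 * κ * t + 1) * v s ≤ 2 * κ * t * v (s + 1) := by
    intro s hs hs'
    rw [hlen] at hs'
    have hv2 : 2 * v s ≤ f t := by
      refine le_trans ?_ hft
      have h1 := hvle s hs hs'.le
      have h2 : 2 * 4 ^ k ≤ 27 ^ k := by
        calc 2 * 4 ^ k ≤ 2 ^ k * 4 ^ k := by
              gcongr
              exact Nat.le_self_pow (by omega) 2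
          _ = 8 ^ k := by rw [← mul_pow]; norm_num
          _ ≤ 27 ^ k := by gcongr; norm_num
      calc 2 * v s ≤ 2 * (4 ^ k * W) := by gcongr
        _ = 2 * 4 ^ k * W := by ring
        _ ≤ _ := by gcongr
    set S₁ := (H.finite_boundary A.finite_toSet).toFinset ∩ B x (s + 1) with hS₁
    have hS₁card : S₁.card ≤ K * (s + 1) := by
      refine H.card_boundary_inter_le hA x (by omega) S₁ fun z hz => ?_
      rw [hS₁, Finset.mem_inter, H.mem_iff, Set.Finite.mem_toFinset] at hz
      exact hz
    have hsub : A ∩ B x s ⊆ A ∩ B x (s + 1) :=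
      Finset.inter_subset_inter_left (H.ball_mono x (Nat.le_succ s))
    have h3 := hI (A ∩ B x s) (S₁ ∪ ((A ∩ B x (s + 1)) \ (A ∩ B x s))) t htpos (by
      rintro z ⟨hz, y, hy, hzy⟩
      rw [Finset.mem_coe, Finset.mem_inter, H.mem_iff] at hy
      have hz1 : X.dist x z ≤ s + 1 := by
        have := hc.dist_triangle (u := x) (v := y) (w := z)
        have : X.dist y z = 1 := dist_eq_one_iff_adj.2 hzy.symm
        omega
      rw [Finset.mem_coe, Finset.mem_union]
      by_cases hzA : z ∈ A
      · exact Or.inr (Finset.mem_sdiff.2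
          ⟨Finset.mem_inter.2 ⟨hzA, (H.mem_iff _ _ _).2 hz1⟩, hz⟩)
      · refine Or.inl (Finset.mem_inter.2 ⟨(Set.Finite.mem_toFinset _).2 ?_,
          (H.mem_iff _ _ _).2 hz1⟩)
        exact ⟨hzA, y, hy.1, hzy⟩) hv2
    have h4 : (S₁ ∪ ((A ∩ B x (s + 1)) \ (A ∩ B x s))).card ≤ K * (s + 1) + (v (s + 1) - v s) := by
      refine (Finset.card_union_le _ _).trans ?_
      rw [Finset.card_sdiff_of_subset hsub]
      exact Nat.add_le_add_right hS₁card _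
    have h5 : v s ≤ κ * t * (K * (s + 1) + (v (s + 1) - v s)) :=
      h3.trans (Nat.mul_le_mul_left _ h4)
    have h6 : 2 * κ * t * (K * (s + 1)) ≤ v s := by
      refine le_trans ?_ (hWlow.trans (hvmono _ _ hs))
      calc 2 * κ * t * (K * (s + 1)) ≤ 2 * κ * t * (K * ((4 + L) * D)) := by
            gcongr
            nlinarith
        _ = 2 * κ * 3 ^ (k + 1) * K * (4 + L) * D ^ 2 := by rw [ht]; ring
        _ ≤ _ := by gcongr; omega
    obtain ⟨w, hw⟩ := Nat.exists_eq_add_of_le (hvmono s (s + 1) (Nat.le_succ s))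
    rw [hw] at h5 ⊢
    rw [Nat.add_sub_cancel_left] at h5
    nlinarith
  have hfin := two_pow_mul_le_of_growth (u := v) (N := 2 * κ * t) (m := 2 * k) (s₀ := 3 * D)
    (Nat.mul_pos (by omega) htpos) hstep
  rw [hlen, pow_mul, show 2 ^ 2 = 4 by norm_num] at hfin
  exact absurd hfin (not_le.2 (hvle ((3 + L) * D) (by nlinarith) le_rfl))

lemma cubic_growth_of_not_massTransport (H : HomogeneousBalls X B f) {κ : ℕ} (hκ : 1 ≤ κ)
    (hI : ∀ Ω S : Finset V, vertexBoundary X (Ω : Set V) ⊆ S → Ω.card ≤ κ * S.card) {r : ℕ}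
    (hr : 5 * κ ≤ r) : 27 * f r ≤ f (3 * r) := by
  classical
  have hc := H.connected
  have hstep : ∀ n, (κ + 1) * f n ≤ κ * f (n + 1) := by
    intro n
    obtain ⟨x⟩ := hc.nonempty
    have h1 := hI (B x n) (B x (n + 1) \ B x n) (by
      rintro z ⟨hz, y, hy, hzy⟩
      rw [Finset.mem_coe, H.mem_iff] at hy
      refine Finset.mem_coe.2 (Finset.mem_sdiff.2 ⟨(H.mem_iff _ _ _).2 ?_, hz⟩)
      have := hc.dist_triangle (u := x) (v := y) (w := z)
      have : X.dist y z = 1 := dist_eq_one_iff_adj.2 hzy.symm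
      omega)
    rw [Finset.card_sdiff_of_subset (H.ball_mono x (Nat.le_succ n)), H.card_eq, H.card_eq] at h1
    obtain ⟨w, hw⟩ := Nat.exists_eq_add_of_le (H.mono (Nat.le_succ n))
    rw [Nat.succ_eq_add_one] at hw
    rw [hw] at h1 ⊢
    rw [Nat.add_sub_cancel_left] at h1
    nlinarith
  have h2 := two_pow_mul_le_of_growth (u := f) (m := 5) (s₀ := r) hκ fun s _ _ => hstep s
  have h3 : f (r + κ * 5) ≤ f (3 * r) := H.mono (by omega)
  omega

lemma exists_mul_sq_lt_of_not_quadGrowth (H : HomogeneousBalls X B f) (hng : ¬ QuadGrowth X)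
    (Q : ℕ) : ∃ r, 1 ≤ r ∧ Q * r ^ 2 < f r := by
  by_contra hcon
  push Not at hcon
  refine hng ⟨Q + 1, by positivity, fun v n hn => ?_⟩
  have h1 : {u : V | X.dist u v ≤ n} = (B v n : Set V) := by
    ext u
    rw [Finset.mem_coe, H.mem_iff, SimpleGraph.dist_comm]
    rfl
  rw [h1, Set.ncard_coe_finset, H.card_eq]
  have h2 : (f n : ℝ) ≤ Q * (n : ℝ) ^ 2 := by exact_mod_cast hcon n hn
  nlinarith [sq_nonneg (n : ℝ)]

/-- A function growing cubically above a quadratic barrier stays above this barrier. -/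
lemma exists_cubic_growth_of_barrier (H : HomogeneousBalls X B f) (hng : ¬ QuadGrowth X) {Q : ℕ}
    (h : ∀ r, 1 ≤ r → Q * r ^ 2 < f r → 27 * f r ≤ f (3 * r)) :
    ∃ r₁, 1 ≤ r₁ ∧ ∀ r, r₁ ≤ r → 27 * f r ≤ f (3 * r) := by
  obtain ⟨r₁, hr₁, hf⟩ := H.exists_mul_sq_lt_of_not_quadGrowth hng (9 * Q)
  refine ⟨r₁, hr₁, ?_⟩
  have h1 : ∀ j, 9 * Q * (3 ^ j * r₁) ^ 2 < f (3 ^ j * r₁) := by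
    intro j
    induction j with
    | zero => simpa using hf
    | succ j ih =>
      have h2 := h (3 ^ j * r₁) (Nat.mul_pos (by positivity) hr₁)
        (lt_of_le_of_lt (by gcongr; omega) ih)
      calc 9 * Q * (3 ^ (j + 1) * r₁) ^ 2 = 9 * (9 * Q * (3 ^ j * r₁) ^ 2) := by ring
        _ < 27 * f (3 ^ j * r₁) := by omega
        _ ≤ f (3 * (3 ^ j * r₁)) := h2
        _ = _ := by ring_nf
  intro r hr
  refine h r (hr₁.trans hr) ?_
  set j := Nat.log 3 (r / r₁) with hj
  have hpos : r / r₁ ≠ 0 := (Nat.div_pos hr hr₁).ne'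
  have h2 : 3 ^ j * r₁ ≤ r := (Nat.le_div_iff_mul_le hr₁).1 (Nat.pow_log_le_self 3 hpos)
  have h3 : r < 3 ^ (j + 1) * r₁ :=
    (Nat.div_lt_iff_lt_mul hr₁).1 (Nat.lt_pow_succ_log_self (by norm_num) _)
  calc Q * r ^ 2 ≤ Q * (3 ^ (j + 1) * r₁) ^ 2 := by gcongr
    _ = 9 * Q * (3 ^ j * r₁) ^ 2 := by ring
    _ < f (3 ^ j * r₁) := h1 j
    _ ≤ f r := H.mono h2

/-- In a homogeneous graph of superquadratic growth, finite sets with linearly spread boundary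
have uniformly bounded depth. -/
theorem exists_depth_bound (H : HomogeneousBalls X B f) (hng : ¬ QuadGrowth X) (K : ℕ) :
    ∃ C₀ : ℕ, ∀ A : Finset V, LinearlySpread X (vertexBoundary X (A : Set V)) K →
      ∀ a ∈ A, ∃ b ∈ vertexBoundary X (A : Set V), X.dist a b ≤ C₀ := by
  by_cases hM : MassTransport X B
  · by_cases hd : ∃ r, 1 ≤ r ∧ 1728 * K * r ^ 2 < f r ∧ f (3 * r) ≤ 27 * f r
    · obtain ⟨r, hr, hf, hd⟩ := hd
      refine ⟨r, fun A hA a ha => ?_⟩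
      by_contra hcon
      push Not at hcon
      exact H.false_of_doubling hM hr hf hd A hA fun y hy =>
        H.mem_of_dist_lt (A := (A : Set V)) (D := r + 1) ha (fun b hb => hcon b hb)
          (Nat.lt_succ_of_le hy)
    · push Not at hd
      obtain ⟨r₁, hr₁, hG⟩ := H.exists_cubic_growth_of_barrier hng
        fun r hr hf => (hd r hr hf).le
      exact H.exists_forall_dist_le hr₁ hG (by norm_num : 1 ≤ 4)
        (fun Ω S t ht hS hΩ => H.card_le_of_massTransport hM ht Ω S hS hΩ) K
  · obtain ⟨κ, hκ, hI⟩ := H.exists_card_le_of_not_massTransport hM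
    refine H.exists_forall_dist_le (by omega : 1 ≤ 5 * κ)
      (fun r hr => H.cubic_growth_of_not_massTransport hκ hI hr) hκ
      (fun Ω S t ht hS _ => (hI Ω S hS).trans ?_) K
    gcongr
    exact Nat.le_mul_of_pos_right _ ht

end HomogeneousBalls

section Spread

variable {V : Type*} {X : SimpleGraph V}

lemma LinearlySpread.mono {S S' : Set V} {K : ℕ} (h : LinearlySpread X S K) (hS : S' ⊆ S) :
    LinearlySpread X S' K := fun x s D Z hD hs hZ hsep =>
  h x s D Z hD hs (fun z hz => ⟨hS (hZ z hz).1, (hZ z hz).2⟩) hsep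

lemma LinearlySpread.union {S S' : Set V} {K K' : ℕ} (h : LinearlySpread X S K)
    (h' : LinearlySpread X S' K') : LinearlySpread X (S ∪ S') (K + K') := by
  classical
  intro x s D Z hD hs hZ hsep
  have h1 := h x s D (Z.filter (· ∈ S)) hD hs
    (fun z hz => ⟨(Finset.mem_filter.1 hz).2, (hZ z (Finset.mem_filter.1 hz).1).2⟩)
    fun z hz z' hz' => hsep z (Finset.mem_filter.1 hz).1 z' (Finset.mem_filter.1 hz').1
  have h2 := h' x s D (Z.filter (· ∉ S)) hD hs
    (fun z hz => ⟨(hZ z (Finset.mem_filter.1 hz).1).1.resolve_left (Finset.mem_filter.1 hz).2,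
      (hZ z (Finset.mem_filter.1 hz).1).2⟩)
    fun z hz z' hz' => hsep z (Finset.mem_filter.1 hz).1 z' (Finset.mem_filter.1 hz').1
  rw [← Finset.card_filter_add_card_filter_not (s := Z) (· ∈ S)]
  rw [add_mul, add_mul]
  exact Nat.add_le_add h1 h2

lemma dist_le_of_path (hc : X.Connected) {p : ℕ → V} {n : ℕ}
    (hadj : ∀ i < n, X.Adj (p i) (p (i + 1))) (i j : ℕ) (h : i + j ≤ n) :
    X.dist (p i) (p (i + j)) ≤ j := by
  induction j with
  | zero => simp
  | succ j ih =>
    have h1 := ih (by omega)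
    have h2 : X.dist (p (i + j)) (p (i + j + 1)) = 1 := dist_eq_one_iff_adj.2 (hadj _ (by omega))
    have := hc.dist_triangle (u := p i) (v := p (i + j)) (w := p (i + j + 1))
    rw [← add_assoc]
    omega

lemma linearlySpread_quasiGeodesic (hc : X.Connected) {lam c : ℝ} (hlam : 1 ≤ lam) (hc0 : 0 ≤ c)
    {p : ℕ → V} {n K : ℕ} (hadj : ∀ i < n, X.Adj (p i) (p (i + 1)))
    (hqg : ∀ s t : ℕ, s ≤ n → t ≤ n → |(s : ℝ) - (t : ℝ)| / lam - c ≤ (X.dist (p s) (p t) : ℝ))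
    (hK : lam * (2 + c) + 1 ≤ K) : LinearlySpread X (p '' Set.Iic n) K := by
  intro x s D Z hD hs hZ hsep
  rcases Z.eq_empty_or_nonempty with rfl | hne
  · simp
  have hex : ∀ z ∈ Z, ∃ i, i ≤ n ∧ p i = z := fun z hz => (hZ z hz).1
  choose! i hi hpi using hex
  obtain ⟨m, hm, hmin⟩ := Z.exists_min_image i hne
  set R := ⌊lam * (2 * s + c)⌋₊ with hR
  have hs1 : (1 : ℝ) ≤ s := by exact_mod_cast hD.trans hs
  have hlen : ∀ z ∈ Z, i z - i m ≤ R := by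
    intro z hz
    refine Nat.le_floor ?_
    rw [Nat.cast_sub (hmin z hz)]
    have h1 := hqg (i z) (i m) (hi z hz) (hi m hm)
    rw [hpi z hz, hpi m hm] at h1
    have h2 : X.dist z m ≤ 2 * s := by
      have := hc.dist_triangle (u := z) (v := x) (w := m)
      have h3 := (hZ z hz).2
      rw [SimpleGraph.dist_comm] at h3
      have := (hZ m hm).2
      omega
    have h3 : (X.dist z m : ℝ) ≤ 2 * s := by exact_mod_cast h2
    have h4 : |(i z : ℝ) - i m| / lam ≤ 2 * s + c := by linarith
    rw [div_le_iff₀ (by linarith)] at h4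
    have := le_abs_self ((i z : ℝ) - i m)
    linarith
  have hclose : ∀ z ∈ Z, ∀ z' ∈ Z, i z ≤ i z' → (i z - i m) / D = (i z' - i m) / D → z = z' := by
    intro z hz z' hz' hle heq
    by_contra hne'
    have h1 := dist_le_of_path hc hadj (i z) (i z' - i z) (by have := hi z' hz'; omega)
    rw [show i z + (i z' - i z) = i z' by omega, hpi z hz, hpi z' hz'] at h1
    have h2 := hsep z hz z' hz' hne'
    have h3 := Nat.div_add_mod (i z - i m) D
    have h4 := Nat.div_add_mod (i z' - i m) D
    have h5 := Nat.mod_lt (i z' - i m) hD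
    have := hmin z hz
    rw [heq] at h3
    omega
  have hinj : Set.InjOn (fun z => (i z - i m) / D) Z := by
    intro z hz z' hz' h
    rcases le_total (i z) (i z') with hle | hle
    · exact hclose z hz z' hz' hle h
    · exact (hclose z' hz' z hz hle h.symm).symm
  have hcard : Z.card ≤ R / D + 1 := by
    have := Finset.card_le_card_of_injOn (t := Finset.range (R / D + 1)) _ (fun z hz =>
      Finset.mem_coe.2 (Finset.mem_range.2 (Nat.lt_succ_of_le
        (Nat.div_le_div_right (c := D) (hlen z hz))))) hinj
    rwa [Finset.card_range] at this
  have h1 : Z.card * D ≤ R + s := by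
    calc Z.card * D ≤ (R / D + 1) * D := Nat.mul_le_mul_right _ hcard
      _ = R / D * D + D := by ring
      _ ≤ R + s := Nat.add_le_add (Nat.div_mul_le_self _ _) hs
  have h2 : ((R + s : ℕ) : ℝ) ≤ K * s := by
    push_cast
    have h3 : (R : ℝ) ≤ lam * (2 * s + c) := Nat.floor_le (by positivity)
    have h4 : lam * c ≤ lam * c * s := le_mul_of_one_le_right (by positivity) hs1
    calc (R : ℝ) + s ≤ (lam * (2 + c) + 1) * s := by nlinarith
      _ ≤ K * s := by gcongr
  exact h1.trans (by exact_mod_cast h2)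

lemma linearlySpread_quasiCircle (hc : X.Connected) {lam c : ℝ} (hlam : 1 ≤ lam) (hc0 : 0 ≤ c)
    {n K : ℕ} {C : ZMod n → V} (hC : IsQuasiCircle X lam c n C)
    (hK : lam * (2 + c) + 1 ≤ K) : LinearlySpread X (Set.range C) (K + K + K) := by
  obtain ⟨hn, hadj, hqg⟩ := hC
  have hn2 : 2 ≤ n := by
    by_contra h
    obtain rfl : n = 1 := by omega
    have := hadj 0
    rw [Subsingleton.elim (0 + 1 : ZMod 1) 0] at this
    exact X.irrefl this
  have : NeZero n := ⟨by omega⟩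
  have hpiece : ∀ k : ℕ, LinearlySpread X
      ((fun s : ℕ => C ((k : ZMod n) + (s : ZMod n))) '' Set.Iic (n / 2)) K := by
    intro k
    refine linearlySpread_quasiGeodesic hc hlam hc0 (fun i _ => ?_) (fun s t hs ht => ?_) hK
    · have := hadj ((k : ZMod n) + (i : ZMod n))
      rw [add_assoc] at this
      simpa using this
    · exact hqg k (n / 2) s t (Nat.mul_div_le n 2) hs ht
  refine (((hpiece 0).union (hpiece (n / 2))).union (hpiece (n / 2 + n / 2))).mono ?_
  rintro _ ⟨z, rfl⟩
  have hz : ((z.val : ℕ) : ZMod n) = z := ZMod.natCast_zmod_val z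
  have hlt := ZMod.val_lt z
  have hmem : ∀ k s : ℕ, k + s = z.val → s ≤ n / 2 →
      C z ∈ (fun s : ℕ => C ((k : ZMod n) + (s : ZMod n))) '' Set.Iic (n / 2) := by
    intro k s hks hs
    refine ⟨s, hs, ?_⟩
    change C _ = C z
    rw [← hz, ← hks, Nat.cast_add]
  by_cases h1 : z.val ≤ n / 2
  · exact Or.inl (Or.inl (hmem 0 z.val (by omega) h1))
  by_cases h2 : z.val ≤ n / 2 + n / 2
  · exact Or.inl (Or.inr (hmem (n / 2) (z.val - n / 2) (by omega) (by omega)))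
  · exact Or.inr (hmem (n / 2 + n / 2) (z.val - (n / 2 + n / 2)) (by omega) (by omega))

lemma linearlySpread_truncQuasiCircle (hc : X.Connected) {lam c : ℝ} (hlam : 1 ≤ lam)
    (hc0 : 0 ≤ c) {F f : ℕ → V} {nF nf K : ℕ} (hT : IsTruncQuasiCircle X lam c F nF f nf)
    (hK : lam * (2 + c) + 1 ≤ K) :
    LinearlySpread X (F '' Set.Iic nF ∪ f '' Set.Iic nf) (K + K + K + K) := by
  obtain ⟨-, hf, -, -, hqg, n, C, hC, -, hCF⟩ := hT
  refine ((linearlySpread_quasiCircle hc hlam hc0 hC hK).mono ?_).union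
    (linearlySpread_quasiGeodesic hc hlam hc0 hf hqg hK)
  rintro _ ⟨i, hi, rfl⟩
  exact ⟨(i : ZMod n), hCF i hi⟩

lemma HomogeneousBalls.linearlySpread_of_near {B : V → ℕ → Finset V} {f : ℕ → ℕ}
    (H : HomogeneousBalls X B f) {S S' : Set V} {K δ : ℕ} (hS : LinearlySpread X S K)
    (hnear : ∀ z ∈ S', ∃ t ∈ S, X.dist z t ≤ δ) :
    LinearlySpread X S' (K * (1 + δ) * (2 + 4 * δ * f δ)) := by
  classical
  intro x s D Z hD hs hZ hsep
  have hc := H.connected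
  choose! g hgS hg using hnear
  have hball : ∀ y ∈ Z.image g, y ∈ S ∧ X.dist x y ≤ s + δ := by
    intro y hy
    obtain ⟨z, hz, rfl⟩ := Finset.mem_image.1 hy
    have := hc.dist_triangle (u := x) (v := z) (w := g z)
    have := hg z (hZ z hz).1
    have := (hZ z hz).2
    exact ⟨hgS z (hZ z hz).1, by omega⟩
  have hsδ : s + δ ≤ (1 + δ) * s := by
    have := Nat.le_mul_of_pos_right δ (hD.trans hs)
    rw [add_mul, one_mul]
    omega
  rcases le_or_gt D (4 * δ) with hle | hlt
  · have h1 : Z.card ≤ f δ * (Z.image g).card := by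
      refine Finset.card_le_mul_card_image Z _ fun y _ => ?_
      rw [← H.card_eq y δ]
      refine Finset.card_le_card fun z hz => ?_
      obtain ⟨hzZ, rfl⟩ := Finset.mem_filter.1 hz
      rw [H.mem_iff, SimpleGraph.dist_comm]
      exact hg z (hZ z hzZ).1
    have h2 := hS x (s + δ) 1 (Z.image g) le_rfl (by omega) hball
      fun z _ z' _ h => hc.pos_dist_of_ne h
    rw [mul_one] at h2
    calc Z.card * D ≤ (f δ * (Z.image g).card) * (4 * δ) := by gcongr
      _ ≤ (f δ * (K * ((1 + δ) * s))) * (4 * δ) := by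
        gcongr
        exact h2.trans (Nat.mul_le_mul_left _ hsδ)
      _ = K * (1 + δ) * (4 * δ * f δ) * s := by ring
      _ ≤ _ := by gcongr; omega
  · have hfar : ∀ z ∈ Z, ∀ z' ∈ Z, z ≠ z' → D - 2 * δ ≤ X.dist (g z) (g z') := by
      intro z hz z' hz' hne
      have h3 := hsep z hz z' hz' hne
      have h4 := hg z (hZ z hz).1
      have h5 := hg z' (hZ z' hz').1
      rw [SimpleGraph.dist_comm] at h5
      have := hc.dist_triangle (u := z) (v := g z) (w := z')
      have := hc.dist_triangle (u := g z) (v := g z') (w := z')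
      omega
    have hinj : Set.InjOn g Z := by
      intro z hz z' hz' h
      by_contra hne
      have := hfar z hz z' hz' hne
      rw [h, SimpleGraph.dist_self] at this
      omega
    have h2 := hS x (s + δ) (D - 2 * δ) (Z.image g) (by omega) (by omega) hball (by
      intro y hy y' hy' hne
      obtain ⟨z, hz, rfl⟩ := Finset.mem_image.1 hy
      obtain ⟨z', hz', rfl⟩ := Finset.mem_image.1 hy'
      exact hfar z hz z' hz' fun h => hne (by rw [h]))
    rw [Finset.card_image_of_injOn hinj] at h2
    calc Z.card * D ≤ Z.card * (2 * (D - 2 * δ)) := by gcongr; omega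
      _ = 2 * (Z.card * (D - 2 * δ)) := by ring
      _ ≤ 2 * (K * ((1 + δ) * s)) :=
        Nat.mul_le_mul_left _ (h2.trans (Nat.mul_le_mul_left _ hsδ))
      _ = K * (1 + δ) * 2 * s := by ring
      _ ≤ _ := by gcongr; omega

/-- The boundary of a component of `S` lies outside `S`. -/
lemma IsCompOf.notMem_of_mem_boundary {A S : Set V} (h : IsCompOf X A S) {v : V}
    (hv : v ∈ vertexBoundary X A) : v ∉ S := by
  intro hvS
  obtain ⟨hvA, a, ha, hva⟩ := hv
  obtain ⟨hAS, -, hconn, hmax⟩ := h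
  have hU : ConnSet X ({v} ∪ A) := by
    exact connected_induce_union (v := v) (w := a) Preconnected.of_subsingleton
      hconn.preconnected rfl ha hva
  have := hmax _ Set.subset_union_right (Set.union_subset (Set.singleton_subset_iff.2 hvS) hAS) hU
  exact hvA (this ▸ Or.inl rfl)

lemma gdepth_le {A : Set V} {C₀ : ℝ} (hC₀ : 0 ≤ C₀)
    (h : ∀ a ∈ A, ∃ b ∈ vertexBoundary X A, (X.dist a b : ℝ) ≤ C₀) : gdepth X A ≤ C₀ :=
  csInf_le ⟨0, fun _ hr => hr.1⟩ ⟨hC₀, h⟩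

end Spread

theorem statement_15 {V : Type*} (X : SimpleGraph V)
    (hinf : Infinite V) (hconn : X.Connected)
    (hlf : ∀ v : V, (X.neighborSet v).Finite)
    (htrans : ∀ u v : V, ∃ φ : X ≃g X, φ u = v)
    (σ : ℝ) (hσ : 0 < σ) (hubq : UBQ X σ)
    (hng : ¬ QuadGrowth X) :
    ∀ lam c : ℝ, 1 ≤ lam → 0 ≤ c → ∀ δ : ℝ, 0 ≤ δ →
      ∃ C : ℝ, 0 ≤ C ∧ ∀ (F : ℕ → V) (nF : ℕ) (f : ℕ → V) (nf : ℕ),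
        IsTruncQuasiCircle X lam c F nF f nf →
        ∀ A : Set V,
          IsCompOf X A ((gnbhd X (F '' Set.Iic nF ∪ f '' Set.Iic nf) δ)ᶜ) →
          A.Finite → gdepth X A < C := by
  intro lam c hlam hc0 δ _
  obtain ⟨B, vol, H⟩ := exists_homogeneousBalls hinf hconn hlf htrans
  obtain ⟨K, hK⟩ := exists_nat_ge (lam * (2 + c) + 1)
  obtain ⟨C₀, hC₀⟩ := H.exists_depth_bound hng
    ((K + K + K + K) * (1 + ⌈δ⌉₊) * (2 + 4 * ⌈δ⌉₊ * vol ⌈δ⌉₊))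
  refine ⟨C₀ + 1, by positivity, fun F nF f nf hT A hA hfin => ?_⟩
  refine lt_of_le_of_lt (gdepth_le (C₀ := C₀) (by positivity) fun a ha => ?_) (lt_add_one _)
  have hspread := H.linearlySpread_of_near (S' := vertexBoundary X A) (δ := ⌈δ⌉₊)
    (linearlySpread_truncQuasiCircle hconn hlam hc0 hT hK) (by
      intro z hz
      obtain ⟨t, ht, htz⟩ := not_not.1 (hA.notMem_of_mem_boundary hz)
      exact ⟨t, ht, by exact_mod_cast htz.trans (Nat.le_ceil δ)⟩)
  have h1 := hC₀ hfin.toFinset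
  rw [hfin.coe_toFinset] at h1
  obtain ⟨b, hb, hab⟩ := h1 hspread a (hfin.mem_toFinset.2 ha)
  exact ⟨b, hb, by exact_mod_cast hab⟩
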